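/- For every k ∈ ℕ and all i,j ∈ {1,…,n}, the (i,j) entry of the k-th power of the matrix L equals V_i^{(n+k−j)} at every point of ℝ^n; moreover for q ∈ U_n the matrix L is invertible and for every k ∈ ℕ the (i,j) entry of (L^{-1})^k equals V_i^{(n−k−j)}. Equivalently, (L^k)_{ij} = V_i^{(n+k−j)} for every integer k when q_n ≠ 0. -/

import Mathlib

open scoped BigOperators

/-- Coordinate of `q` with the conventions `q₀ = 1` and `q_α = 0` for `α < 0` or `α > n`
(1-based indexing by an integer). -/
def qc (n : ℕ) (q : Fin n → ℝ) (r : ℤ) : ℝ :=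
  if r = 0 then 1
  else if h : 1 ≤ r ∧ r ≤ (n : ℤ) then q ⟨(r - 1).toNat, by omega⟩ else 0

/-- The Benenti potentials `V_r^{(k)}` in `n` variables. -/
noncomputable def benenti (n : ℕ) (r k : ℤ) (q : Fin n → ℝ) : ℝ :=
  if r < 1 ∨ (n : ℤ) < r then 0
  else if k = 0 then (if r = (n : ℤ) then 1 else 0)
  else if 0 < k then
    benenti n (r + 1) (k - 1) q - qc n q r * benenti n 1 (k - 1) q
  else
    benenti n (r - 1) (k + 1) q - (qc n q (r - 1) / qc n q n) * benenti n n (k + 1) q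
termination_by k.natAbs
decreasing_by all_goals omega

/-- Partial derivative of `f` with respect to the `i`-th coordinate at `q`. -/
noncomputable def pd {n : ℕ} (f : (Fin n → ℝ) → ℝ) (i : Fin n) (q : Fin n → ℝ) : ℝ :=
  deriv (fun t => f (Function.update q i t)) (q i)

/-- Euler–Lagrange expression `E_l(L)[c](x)` of a Lagrangian density `L(q,p)`
along a curve `c`. -/
noncomputable def elExpr {n : ℕ} (L : (Fin n → ℝ) → (Fin n → ℝ) → ℝ) (l : Fin n)
    (c : ℝ → Fin n → ℝ) (x : ℝ) : ℝ :=
  pd (fun vq => L vq (deriv c x)) l (c x)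
    - deriv (fun y => pd (fun vp => L (c y) vp) l (deriv c y)) x

/-- The Lagrangian density `L^{n,m,k}`. -/
noncomputable def lag (n : ℕ) (m k : ℤ) (q p : Fin n → ℝ) : ℝ :=
  (1 / 2) * ∑ i : Fin n, ∑ j : Fin n,
      benenti n 1 (2 * (n : ℤ) - m - ((i : ℕ) + 1) - ((j : ℕ) + 1)) q * p i * p j
    - benenti n 1 k q

/-- The matrix `L` of the Benenti class in Viète coordinates. -/
def Lmat (n : ℕ) (q : Fin n → ℝ) : Matrix (Fin n) (Fin n) ℝ :=
  Matrix.of fun i j => if (j : ℕ) = 0 then -q i else if (j : ℕ) = (i : ℕ) + 1 then 1 else 0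

theorem aux_out (n : ℕ) (r k : ℤ) (q : Fin n → ℝ) (h : r < 1 ∨ (n : ℤ) < r) :
    benenti n r k q = 0 := by
  rw [benenti, if_pos h]

theorem aux_zero (n : ℕ) (r : ℤ) (q : Fin n → ℝ) (h : 1 ≤ r) (h' : r ≤ n) :
    benenti n r 0 q = if r = (n : ℤ) then 1 else 0 := by
  rw [benenti, if_neg (by omega), if_pos rfl]

theorem aux_pos (n : ℕ) (r k : ℤ) (q : Fin n → ℝ) (h : 1 ≤ r) (h' : r ≤ n) (hk : 0 ≤ k) :
    benenti n r (k + 1) q = benenti n (r + 1) k q - qc n q r * benenti n 1 k q := by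
  rw [benenti, if_neg (by omega), if_neg (by omega), if_pos (by omega), add_sub_cancel_right]

theorem aux_neg (n : ℕ) (r k : ℤ) (q : Fin n → ℝ) (h : 1 ≤ r) (h' : r ≤ n) (hk : k < 0) :
    benenti n r k q = benenti n (r - 1) (k + 1) q
      - (qc n q (r - 1) / qc n q n) * benenti n n (k + 1) q := by
  rw [benenti, if_neg (by omega), if_neg (by omega), if_neg (by omega)]

theorem aux_qc (n : ℕ) (q : Fin n → ℝ) (i : Fin n) : qc n q ((i : ℕ) + 1) = q i := by
  have := i.2
  rw [qc, if_neg (by omega), dif_pos (by omega)]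
  congr 1
  ext
  simp

theorem aux_step (n : ℕ) (q : Fin n → ℝ) (r k : ℤ) (h : 1 ≤ r) (h' : r ≤ n)
    (hk : 0 ≤ k ∨ qc n q n ≠ 0) :
    benenti n (r + 1) k q - qc n q r * benenti n 1 k q = benenti n r (k + 1) q := by
  by_cases hk0 : 0 ≤ k
  · rw [aux_pos n r k q h h' hk0]
  · have hq := hk.resolve_left hk0
    have h1 := aux_neg n 1 k q (by omega) (by omega) (by omega)
    rw [aux_out n (1 - 1) _ q (by omega)] at h1
    have h0 : qc n q (1 - 1) = 1 := by simp [qc]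
    rw [h0] at h1
    by_cases hr : r = n
    · rw [aux_out n (r + 1) _ q (by omega), h1, hr]
      field_simp
      ring
    · rw [h1, aux_neg n (r + 1) k q (by omega) (by omega) (by omega), add_sub_cancel_right]
      ring

theorem aux_delta (n : ℕ) (q : Fin n → ℝ) (j : ℕ) : ∀ (r : ℤ), j < n → 1 ≤ r → r ≤ n →
    benenti n r j q = if r = (n : ℤ) - j then 1 else 0 := by
  induction j with
  | zero => intro r _ h h'; simpa using aux_zero n r q h h'
  | succ j ih =>
    intro r hj h h'
    push_cast
    rw [aux_pos n r j q h h' (by omega), ih 1 (by omega) (by omega) (by omega),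
      if_neg (by omega : ¬ (1 : ℤ) = n - j), mul_zero, sub_zero]
    by_cases hr : r = n
    · rw [aux_out n _ _ q (by omega), if_neg (by omega)]
    · rw [ih (r + 1) (by omega) (by omega) (by omega)]
      congr 1
      apply propext
      omega

theorem aux_mulVec (n : ℕ) (q : Fin n → ℝ) (i : Fin n) (f : ℤ → ℝ)
    (hf : f (n + 1) = 0) :
    ∑ l : Fin n, Lmat n q i l * f ((l : ℕ) + 1) = f ((i : ℕ) + 1 + 1) - q i * f 1 := by
  obtain ⟨m, rfl⟩ : ∃ m, n = m + 1 := ⟨n - 1, by have := i.2; omega⟩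
  rw [Fin.sum_univ_succ]
  have : ∑ l : Fin m, Lmat (m + 1) q i l.succ * f ((l.succ : ℕ) + 1) = f ((i : ℕ) + 1 + 1) := by
    by_cases hi : (i : ℕ) < m
    · rw [Finset.sum_eq_single ⟨i, hi⟩]
      · simp [Lmat]
      · intro b _ hb
        have : (b : ℕ) ≠ i := fun h => hb (Fin.ext h)
        simp [Lmat, this]
      · simp
    · have him : (i : ℕ) = m := by have := i.2; omega
      rw [him]
      push_cast at hf
      rw [hf]
      apply Finset.sum_eq_zero
      intro b _
      have : (b : ℕ) ≠ i := by have := b.2; omega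
      simp [Lmat, this]
  rw [this]
  simp [Lmat]
  ring

/-- Candidate for the powers. -/
noncomputable def auxW (n : ℕ) (q : Fin n → ℝ) (k : ℤ) : Matrix (Fin n) (Fin n) ℝ :=
  Matrix.of fun i j => benenti n ((i : ℕ) + 1) ((n : ℤ) + k - ((j : ℕ) + 1)) q

theorem auxW_zero (n : ℕ) (q : Fin n → ℝ) : auxW n q 0 = 1 := by
  ext i j
  have hi := i.2
  have hj := j.2
  have e : (n : ℤ) + 0 - ((j : ℕ) + 1) = ((n - (j + 1) : ℕ) : ℤ) := by omega
  simp only [auxW, Matrix.of_apply]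
  rw [e, aux_delta n q _ _ (by omega) (by omega) (by omega), Matrix.one_apply]
  congr 1
  apply propext
  rw [Fin.ext_iff]
  omega

theorem auxW_mul (n : ℕ) (q : Fin n → ℝ) (k : ℤ) (hk : 0 ≤ k ∨ qc n q n ≠ 0) :
    Lmat n q * auxW n q k = auxW n q (k + 1) := by
  ext i j
  have hi := i.2
  have hj := j.2
  rw [Matrix.mul_apply]
  simp only [auxW, Matrix.of_apply]
  rw [aux_mulVec n q i (fun r => benenti n r ((n : ℤ) + k - ((j : ℕ) + 1)) q)
    (aux_out n _ _ q (by omega)), ← aux_qc n q i,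
    aux_step n q _ _ (by omega) (by omega) (hk.imp (by omega) id)]
  congr 1
  ring

/-- for every `k ∈ ℕ`, `(L^k)_{ij} = V_i^{(n+k−j)}` on all of `ℝ^n`;
moreover, when `q_n ≠ 0` the matrix `L` is invertible, `((L⁻¹)^k)_{ij} = V_i^{(n−k−j)}`,
and `(L^k)_{ij} = V_i^{(n+k−j)}` for every integer `k`. -/
theorem benenti_L_power_entries (n : ℕ) (hn : 1 ≤ n) (q : Fin n → ℝ) :
    (∀ (k : ℕ) (i j : Fin n),
        (Lmat n q ^ k) i j
          = benenti n ((i : ℕ) + 1) ((n : ℤ) + k - ((j : ℕ) + 1)) q)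
      ∧ (q ⟨n - 1, by omega⟩ ≠ 0 →
        IsUnit (Lmat n q)
          ∧ (∀ (k : ℕ) (i j : Fin n),
              ((Lmat n q)⁻¹ ^ k) i j
                = benenti n ((i : ℕ) + 1) ((n : ℤ) - k - ((j : ℕ) + 1)) q)
          ∧ (∀ (k : ℤ) (i j : Fin n),
              (Lmat n q ^ k) i j
                = benenti n ((i : ℕ) + 1) ((n : ℤ) + k - ((j : ℕ) + 1)) q)) := by
  have hnat : ∀ k : ℕ, Lmat n q ^ k = auxW n q k := by
    intro k
    induction k with
    | zero => simp [auxW_zero]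
    | succ k ih =>
      rw [pow_succ', ih, auxW_mul n q k (Or.inl (by omega))]
      push_cast
      rfl
  refine ⟨fun k i j => by rw [hnat]; rfl, fun hq => ?_⟩
  have hq' : qc n q n ≠ 0 := by
    have := aux_qc n q ⟨n - 1, by omega⟩
    have e : (((n - 1 : ℕ) : ℤ) + 1) = n := by omega
    simp only [e] at this
    rwa [this]
  have hinv : Lmat n q * auxW n q (-1) = 1 := by
    rw [auxW_mul n q _ (Or.inr hq'), ← auxW_zero n q]
    rfl
  have hu : IsUnit (Lmat n q) := IsUnit.of_mul_eq_one _ hinv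
  have hdet : IsUnit (Lmat n q).det := (Matrix.isUnit_iff_isUnit_det _).1 hu
  have hneg : ∀ k : ℕ, (Lmat n q)⁻¹ ^ k = auxW n q (-k) := by
    intro k
    induction k with
    | zero => simp [auxW_zero]
    | succ k ih =>
      have h2 := auxW_mul n q (-((k : ℤ) + 1)) (Or.inr hq')
      rw [show -((k : ℤ) + 1) + 1 = -k by ring] at h2
      rw [pow_succ', ih, ← h2, Matrix.nonsing_inv_mul_cancel_left _ _ hdet]
      push_cast
      rfl
  refine ⟨hu, fun k i j => by rw [hneg, sub_eq_add_neg (n : ℤ) k]; rfl, fun k i j => ?_⟩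
  have : Lmat n q ^ k = auxW n q k := by
    obtain ⟨m, rfl | rfl⟩ := k.eq_nat_or_neg
    · rw [zpow_natCast, hnat]
    · rw [Matrix.zpow_neg_natCast, ← Matrix.inv_pow', hneg]
  rw [this]
  rfl
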